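/- Let (μ_x) be a family of probability measures on ℝ indexed by x → ∞ such that for every nonnegative integer n, the n-th moment ∫ t^n dμ_x converges to (2m)!/(m!2^m) when n = 2m is even and to 0 when n is odd. Then μ_x converges weakly to the standard Gaussian measure, i.e., μ_x([a,b]) → (1/√(2π))∫_a^b e^{-t²/2} dt for all a < b. -/

import Mathlib

open Filter MeasureTheory Real

/-- Taylor bound for `exp (i y)` with real `y`, with no exponential factor. -/
theorem norm_cexp_mul_I_sub_sum_le (n : ℕ) (y : ℝ) :
    ‖Complex.exp (y * Complex.I) -
      ∑ k ∈ Finset.range n, (y * Complex.I) ^ k / (k.factorial : ℂ)‖ ≤ |y| ^ n / n.factorial := by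
  have nonneg_case : ∀ n : ℕ, ∀ y : ℝ, 0 ≤ y → ‖Complex.exp (y * Complex.I) -
      ∑ k ∈ Finset.range n, (y * Complex.I) ^ k / (k.factorial : ℂ)‖ ≤ y ^ n / n.factorial := by
    intro n
    induction n with
    | zero => intro y _; simp [Complex.norm_exp_ofReal_mul_I]
    | succ n ih =>
      intro y hy
      have hlin (x : ℝ) : HasDerivAt (fun x : ℝ => (x : ℂ) * Complex.I) Complex.I x := by
        simpa using (Complex.ofRealCLM.hasDerivAt (x := x)).mul_const Complex.I
      have hderiv (x : ℝ) : HasDerivAt (fun x : ℝ => Complex.exp (x * Complex.I) -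
          ∑ k ∈ Finset.range (n + 1), (x * Complex.I) ^ k / (k.factorial : ℂ))
          (Complex.I * (Complex.exp (x * Complex.I) -
            ∑ k ∈ Finset.range n, (x * Complex.I) ^ k / (k.factorial : ℂ))) x := by
        have hsum : HasDerivAt (fun x : ℝ =>
            ∑ k ∈ Finset.range (n + 1), (x * Complex.I) ^ k / (k.factorial : ℂ))
            (∑ k ∈ Finset.range (n + 1),
              (k * (x * Complex.I) ^ (k - 1) * Complex.I) / (k.factorial : ℂ)) x :=
          HasDerivAt.fun_sum fun k _ => ((hlin x).pow k).div_const _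
        refine ((hlin x).cexp.sub hsum).congr_deriv ?_
        rw [Finset.sum_range_succ', mul_sub, Finset.mul_sum, mul_comm Complex.I (Complex.exp _)]
        simp only [Nat.cast_zero, zero_mul, zero_div, add_zero]
        congr 1
        refine Finset.sum_congr rfl fun k _ => ?_
        have h1 : (k.factorial : ℂ) ≠ 0 := by exact_mod_cast k.factorial_ne_zero
        have h2 : ((k : ℂ) + 1) ≠ 0 := by exact_mod_cast k.succ_ne_zero
        simp only [Nat.add_sub_cancel, Nat.factorial_succ, Nat.cast_mul, Nat.cast_add,
          Nat.cast_one]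
        field_simp
      have hB (x : ℝ) : HasDerivAt (fun x : ℝ => x ^ (n + 1) / ((n + 1).factorial : ℝ))
          (x ^ n / n.factorial) x := by
        refine ((hasDerivAt_pow (n + 1) x).div_const _).congr_deriv ?_
        have h1 : (n.factorial : ℝ) ≠ 0 := by exact_mod_cast n.factorial_ne_zero
        simp only [Nat.add_sub_cancel, Nat.factorial_succ, Nat.cast_mul, Nat.cast_add,
          Nat.cast_one]
        field_simp
      refine image_norm_le_of_norm_deriv_right_le_deriv_boundary (a := 0) (b := y)
        (fun x _ => (hderiv x).continuousAt.continuousWithinAt)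
        (fun x _ => (hderiv x).hasDerivWithinAt) ?_ hB ?_ ⟨hy, le_rfl⟩
      · simp [Finset.sum_range_succ']
      · intro x hx
        simpa using ih x hx.1
  rcases le_total 0 y with hy | hy
  · simpa [abs_of_nonneg hy] using nonneg_case n y hy
  · have h := nonneg_case n (-y) (by linarith)
    rw [abs_of_nonpos hy, ← Complex.norm_conj]
    simpa [← Complex.exp_conj] using h

/-- Approximation of the characteristic function by its Taylor polynomial, with an error
controlled by the absolute moment of the next order. -/
theorem norm_charFun_sub_sum_moments_le (μ : Measure ℝ) [IsProbabilityMeasure μ] {n : ℕ}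
    (hpow_n : Integrable (fun t : ℝ => t ^ n) μ) (s : ℝ) :
    ‖charFun μ s - ∑ k ∈ Finset.range n,
      (s * Complex.I) ^ k / (k.factorial : ℂ) * ((∫ t : ℝ, t ^ k ∂μ : ℝ) : ℂ)‖ ≤
      |s| ^ n / n.factorial * ∫ t : ℝ, |t| ^ n ∂μ := by
  have hpow {k : ℕ} (hk : k ∈ Finset.range n) : Integrable (fun t : ℝ => t ^ k) μ := by
    refine (integrable_norm_iff (by fun_prop)).1 ?_
    simpa using integrable_norm_pow_of_le (f := fun t : ℝ => t) (by fun_prop)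
      (Finset.mem_range.1 hk).le (by simpa using hpow_n.norm)
  have hterm {k : ℕ} (hk : k ∈ Finset.range n) :
      Integrable (fun t : ℝ => (s * Complex.I) ^ k / (k.factorial : ℂ) * ((t ^ k : ℝ) : ℂ)) μ :=
    (hpow hk).ofReal.const_mul _
  have hexp : Integrable (fun t : ℝ => Complex.exp (s * t * Complex.I)) μ := by
    refine Integrable.of_bound (C := 1) (by fun_prop) (ae_of_all _ fun t => ?_)
    rw [← Complex.ofReal_mul, Complex.norm_exp_ofReal_mul_I]
  have heq : charFun μ s - ∑ k ∈ Finset.range n,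
      (s * Complex.I) ^ k / (k.factorial : ℂ) * ((∫ t : ℝ, t ^ k ∂μ : ℝ) : ℂ) =
      ∫ t : ℝ, (Complex.exp (s * t * Complex.I) - ∑ k ∈ Finset.range n,
        (s * Complex.I) ^ k / (k.factorial : ℂ) * ((t ^ k : ℝ) : ℂ)) ∂μ := by
    rw [integral_sub hexp (integrable_finsetSum _ fun k hk => hterm hk),
      integral_finsetSum _ fun k hk => hterm hk, charFun_apply_real]
    simp only [integral_const_mul, integral_complex_ofReal]
  rw [heq, ← integral_const_mul]
  refine norm_integral_le_of_norm_le ?_ (ae_of_all _ fun t => ?_)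
  · simpa using hpow_n.norm.const_mul (|s| ^ n / n.factorial)
  · have h := norm_cexp_mul_I_sub_sum_le n (s * t)
    rw [abs_mul, mul_pow] at h
    convert h using 1
    · congr 2
      · push_cast; rfl
      · refine Finset.sum_congr rfl fun k _ => ?_
        push_cast
        ring
    · ring

/-- The even moments of the standard Gaussian are `(2m)! / (m! 2ᵐ)`, the odd ones vanish. -/
noncomputable def stdGaussianMoment (n : ℕ) : ℝ :=
  if Even n then (n.factorial : ℝ) / ((n / 2).factorial * 2 ^ (n / 2)) else 0

theorem stdGaussianMoment_two_mul (m : ℕ) :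
    stdGaussianMoment (2 * m) = ((2 * m).factorial : ℝ) / (m.factorial * 2 ^ m) := by
  simp [stdGaussianMoment]

theorem sum_stdGaussianMoment (s : ℝ) (m : ℕ) :
    ∑ k ∈ Finset.range (2 * m),
      (s * Complex.I) ^ k / (k.factorial : ℂ) * (stdGaussianMoment k : ℂ) =
      ∑ k ∈ Finset.range m, (-(s : ℂ) ^ 2 / 2) ^ k / (k.factorial : ℂ) := by
  induction m with
  | zero => simp
  | succ m ih =>
    have hodd : stdGaussianMoment (2 * m + 1) = 0 := by simp [stdGaussianMoment]
    have h1 : ((2 * m).factorial : ℂ) ≠ 0 := by exact_mod_cast (2 * m).factorial_ne_zero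
    have h2 : (m.factorial : ℂ) ≠ 0 := by exact_mod_cast m.factorial_ne_zero
    rw [show 2 * (m + 1) = 2 * m + 1 + 1 by ring, Finset.sum_range_succ, Finset.sum_range_succ,
      ih, Finset.sum_range_succ, hodd, stdGaussianMoment_two_mul, pow_mul, mul_pow, Complex.I_sq,
      div_pow]
    push_cast
    field_simp
    simp

/-- Convergence of all moments to the Gaussian ones implies pointwise convergence of the
characteristic functions. -/
theorem tendsto_charFun_of_tendsto_moments {ι : Type*} {l : Filter ι} (μ : ι → Measure ℝ)
    [∀ i, IsProbabilityMeasure (μ i)]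
    (hmom : ∀ n : ℕ, Tendsto (fun i => ∫ t : ℝ, t ^ n ∂μ i) l (nhds (stdGaussianMoment n)))
    (s : ℝ) :
    Tendsto (fun i => charFun (μ i) s) l (nhds (Complex.exp (-(s : ℂ) ^ 2 / 2))) := by
  rw [Metric.tendsto_nhds]
  intro ε hε
  have hexp : Tendsto (fun m => ∑ k ∈ Finset.range m, (-(s : ℂ) ^ 2 / 2) ^ k / (k.factorial : ℂ))
      atTop (nhds (Complex.exp (-(s : ℂ) ^ 2 / 2))) := by
    rw [Complex.exp_eq_exp_ℂ]
    exact (NormedSpace.expSeries_div_hasSum_exp (-(s : ℂ) ^ 2 / 2)).tendsto_sum_nat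
  have hrem := FloorSemiring.tendsto_pow_div_factorial_atTop (s ^ 2 / 2)
  obtain ⟨m, hm1, hm2⟩ := ((Metric.tendsto_nhds.1 hexp (ε / 3) (by positivity)).and
    (hrem.eventually_lt_const (show (0 : ℝ) < ε / 3 by positivity))).exists
  have hpoly : Tendsto (fun i => ∑ k ∈ Finset.range (2 * m),
      (s * Complex.I) ^ k / (k.factorial : ℂ) * ((∫ t : ℝ, t ^ k ∂μ i : ℝ) : ℂ)) l
      (nhds (∑ k ∈ Finset.range m, (-(s : ℂ) ^ 2 / 2) ^ k / (k.factorial : ℂ))) := by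
    rw [← sum_stdGaussianMoment]
    exact tendsto_finsetSum _ fun k _ =>
      ((Complex.continuous_ofReal.tendsto _).comp (hmom k)).const_mul _
  have hbound : Tendsto (fun i => |s| ^ (2 * m) / (2 * m).factorial * ∫ t : ℝ, t ^ (2 * m) ∂μ i) l
      (nhds ((s ^ 2 / 2) ^ m / m.factorial)) := by
    convert (hmom (2 * m)).const_mul (|s| ^ (2 * m) / (2 * m).factorial) using 2
    rw [stdGaussianMoment_two_mul, pow_mul, sq_abs, div_pow]
    field_simp
  have hpos : 0 < stdGaussianMoment (2 * m) := by
    rw [stdGaussianMoment_two_mul]; positivity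
  filter_upwards [Metric.tendsto_nhds.1 hpoly (ε / 3) (by positivity),
    hbound.eventually_lt_const hm2, (hmom (2 * m)).eventually_const_lt hpos] with i hi1 hi2 hi3
  have h := norm_charFun_sub_sum_moments_le (μ i) (.of_integral_ne_zero hi3.ne') s
  simp only [(even_two_mul m).pow_abs] at h hi2
  rw [← dist_eq_norm] at h
  have t1 := dist_triangle4 (charFun (μ i) s) (∑ k ∈ Finset.range (2 * m),
      (s * Complex.I) ^ k / (k.factorial : ℂ) * ((∫ t : ℝ, t ^ k ∂μ i : ℝ) : ℂ))
      (∑ k ∈ Finset.range m, (-(s : ℂ) ^ 2 / 2) ^ k / (k.factorial : ℂ))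
      (Complex.exp (-(s : ℂ) ^ 2 / 2))
  linarith

theorem gaussianReal_Icc_toReal {a b : ℝ} (hab : a ≤ b) :
    (ProbabilityTheory.gaussianReal 0 1 (Set.Icc a b)).toReal =
      (1 / Real.sqrt (2 * π)) * ∫ t in a..b, Real.exp (-t ^ 2 / 2) := by
  rw [ProbabilityTheory.gaussianReal_apply_eq_integral 0 one_ne_zero, ENNReal.toReal_ofReal
    (integral_nonneg fun _ => ProbabilityTheory.gaussianPDFReal_nonneg _ _ _),
    integral_Icc_eq_integral_Ioc, intervalIntegral.integral_of_le hab, ← integral_const_mul]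
  simp [ProbabilityTheory.gaussianPDFReal]

/-- Fréchet–Shohat for the Gaussian: if a family `μ x` of probability
measures on `ℝ` has all moments converging (as `x → ∞`) to the Gaussian moments
`(2m)!/(m! 2ᵐ)` for even `n = 2m` and `0` for odd `n`, then `μ x [a,b]` converges to the
standard Gaussian probability of `[a,b]` for all `a < b`. -/
theorem stmt_10 (μ : ℝ → Measure ℝ) (hprob : ∀ x, IsProbabilityMeasure (μ x))
    (heven : ∀ m : ℕ, Tendsto (fun x => ∫ t : ℝ, t ^ (2 * m) ∂μ x) atTop
      (nhds ((Nat.factorial (2 * m) : ℝ) / (Nat.factorial m * 2 ^ m))))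
    (hodd : ∀ n : ℕ, Odd n → Tendsto (fun x => ∫ t : ℝ, t ^ n ∂μ x) atTop (nhds 0)) :
    ∀ a b : ℝ, a < b →
      Tendsto (fun x => (μ x (Set.Icc a b)).toReal) atTop
        (nhds ((1 / Real.sqrt (2 * π)) * ∫ t in a..b, Real.exp (-t ^ 2 / 2))) := by
  intro a b hab
  have hmom (n : ℕ) :
      Tendsto (fun x => ∫ t : ℝ, t ^ n ∂μ x) atTop (nhds (stdGaussianMoment n)) := by
    rcases Nat.even_or_odd' n with ⟨m, rfl | rfl⟩
    · rw [stdGaussianMoment_two_mul]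
      exact heven m
    · simpa [stdGaussianMoment] using hodd (2 * m + 1) (odd_two_mul_add_one m)
  rw [← gaussianReal_Icc_toReal hab.le]
  refine tendsto_of_seq_tendsto fun u hu => ?_
  let ν : ℕ → ProbabilityMeasure ℝ := fun k => ⟨μ (u k), hprob _⟩
  let γ : ProbabilityMeasure ℝ := ⟨ProbabilityTheory.gaussianReal 0 1, inferInstance⟩
  have hν : Tendsto ν atTop (nhds γ) := by
    refine ProbabilityMeasure.tendsto_of_tendsto_charFun fun s => ?_
    have h := (tendsto_charFun_of_tendsto_moments μ hmom s).comp hu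
    have hγ : charFun (γ : Measure ℝ) s = Complex.exp (-(s : ℂ) ^ 2 / 2) := by
      change charFun (ProbabilityTheory.gaussianReal 0 1) s = _
      rw [ProbabilityTheory.charFun_gaussianReal]
      congr 1
      push_cast
      ring
    rw [hγ]
    exact h
  have hfrontier : (γ : Measure ℝ) (frontier (Set.Icc a b)) = 0 := by
    refine ProbabilityTheory.gaussianReal_absolutelyContinuous 0 one_ne_zero ?_
    rw [frontier_Icc hab.le]
    exact (Set.toFinite _).measure_zero _
  exact (ENNReal.tendsto_toReal (measure_ne_top _ _)).comp
    (ProbabilityMeasure.tendsto_measure_of_null_frontier_of_tendsto' hν hfrontier)
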